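/- arXiv:2001.04410 — 8 statements merged into one kernel-verified Lean document; each statement's English description precedes it below -/
import Mathlib

section
/- Let X and Y be topological spaces and let f : X → Y be surjective (no continuity assumed). Then f is countably perfect — for every countably generated filter G on X and every y ∈ Y, if y is a cluster point of Filter.map f G then there exists x with f x = y such that x is a cluster point of G — if and only if f is a closed map and every fiber f⁻¹{y} is countably compact, in the sense that every countably generated filter F ≠ ⊥ on X all of whose members meet f⁻¹{y} has a cluster point belonging to f⁻¹{y}. -/
theorem stmt_8 {X Y : Type*} [TopologicalSpace X] [TopologicalSpace Y]
    (f : X → Y) (hf : Function.Surjective f) :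
    (∀ G : Filter X, G.IsCountablyGenerated →
        ∀ y : Y, ClusterPt y (Filter.map f G) → ∃ x, f x = y ∧ ClusterPt x G) ↔
      (IsClosedMap f ∧
        ∀ y : Y, ∀ F : Filter X, F.IsCountablyGenerated → F ≠ ⊥ →
          (∀ s ∈ F, (s ∩ f ⁻¹' {y}).Nonempty) →
            ∃ x ∈ f ⁻¹' {y}, ClusterPt x F) := by
  constructor
  · intro h
    refine ⟨fun C hC => ?_, fun y F hF _ hm => ?_⟩
    · refine isClosed_of_closure_subset fun y hy => ?_
      rw [mem_closure_iff_clusterPt, ← Filter.map_principal] at hy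
      obtain ⟨x, hx, hxC⟩ := h _ inferInstance y hy
      rw [← mem_closure_iff_clusterPt, hC.closure_eq] at hxC
      exact ⟨x, hxC, hx⟩
    · obtain ⟨x, hx, hxF⟩ := h F hF y (by
        rw [clusterPt_iff_nonempty]
        intro U hU V hV
        obtain ⟨z, hz, hzy⟩ := hm _ hV
        have hzy : f z = y := hzy
        exact ⟨y, mem_of_mem_nhds hU, hzy ▸ hz⟩)
      exact ⟨x, hx, hxF⟩
  · rintro ⟨hc, hk⟩ G hG y hy
    obtain ⟨B, hB⟩ := G.exists_antitone_basis
    have hL := hB.toHasBasis.lift'_closure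
    have hm : ∀ s ∈ G.lift' closure, (s ∩ f ⁻¹' {y}).Nonempty := by
      intro s hs
      obtain ⟨n, -, hn⟩ := hL.mem_iff.1 hs
      have h1 : y ∈ closure (f '' B n) := by
        rw [mem_closure_iff_clusterPt]
        exact hy.mono (Filter.le_principal_iff.2 (Filter.image_mem_map (hB.mem n)))
      obtain ⟨x, hx, hxy⟩ := (hc.closure_image_subset (B n)) h1
      exact ⟨x, hn hx, hxy⟩
    obtain ⟨x, hx, hxF⟩ := hk y (G.lift' closure)
      (Filter.HasCountableBasis.isCountablyGenerated ⟨hL, Set.to_countable _⟩)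
      (fun h => by
        obtain ⟨z, hz, _⟩ := hm ∅ (by simp [h])
        exact hz) hm
    exact ⟨x, hx, clusterPt_lift'_closure_iff.1 hxF⟩
end

section
/- Let X and Y be topological spaces and let f : X → Y be surjective (no continuity assumed). Then f is biquotient — for every filter H on Y and every y ∈ Y, if y is a cluster point of H then there exists x with f x = y and x a cluster point of Filter.comap f H — if and only if for every y ∈ Y and every family (U_i)_{i ∈ ι} of open subsets of X with f⁻¹{y} ⊆ ⋃_i U_i, there exists a finite subset t ⊆ ι such that ⋃_{i ∈ t} f '' U_i is a neighborhood of y. -/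
open Filter Topology

theorem stmt_10 {X Y : Type u} [TopologicalSpace X] [TopologicalSpace Y]
    (f : X → Y) (hf : Function.Surjective f) :
    (∀ (H : Filter Y) (y : Y),
        ClusterPt y H → ∃ x, f x = y ∧ ClusterPt x (Filter.comap f H)) ↔
      (∀ (y : Y) (ι : Type u) (U : ι → Set X), (∀ i, IsOpen (U i)) →
        f ⁻¹' {y} ⊆ ⋃ i, U i →
          ∃ t : Finset ι, (⋃ i ∈ t, f '' U i) ∈ 𝓝 y) := by
  classical
  constructor
  · intro h y ι U hU hcov
    by_contra! hcon
    let W : Finset ι → Set Y := fun t => (⋃ i ∈ t, f '' U i)ᶜ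
    have hW : ∀ s t : Finset ι, s ⊆ t → W t ⊆ W s := fun s t hst =>
      Set.compl_subset_compl.2 (Set.biUnion_subset_biUnion_left hst)
    have hdir : Directed (· ≥ ·) W := fun s t =>
      ⟨s ∪ t, hW _ _ Finset.subset_union_left, hW _ _ Finset.subset_union_right⟩
    have hb := Filter.hasBasis_iInf_principal hdir
    have hcl : ClusterPt y (⨅ t, 𝓟 (W t)) := by
      rw [clusterPt_iff_nonempty]
      intro A hA B hB
      obtain ⟨t, -, ht⟩ := hb.mem_iff.1 hB
      by_contra hne
      apply hcon t
      filter_upwards [hA] with z hz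
      by_contra hz'
      exact hne ⟨z, hz, ht hz'⟩
    obtain ⟨x, hx, hc⟩ := h _ y hcl
    obtain ⟨i, hi⟩ := Set.mem_iUnion.1 (hcov (show x ∈ f ⁻¹' {y} from hx))
    rw [clusterPt_iff_nonempty] at hc
    obtain ⟨z, hz1, hz2⟩ := hc ((hU i).mem_nhds hi)
      (preimage_mem_comap (hb.mem_of_mem (i := {i}) trivial))
    apply hz2
    simp only [Set.mem_iUnion]
    exact ⟨i, Finset.mem_singleton_self i, z, hz1, rfl⟩
  · intro h H y hy
    by_contra! hcon
    have key : ∀ x : {x // f x = y}, ∃ U : Set X, IsOpen U ∧ x.1 ∈ U ∧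
        ∃ V ∈ H, ∀ z ∈ U, f z ∉ V := by
      intro x
      have hx := hcon x.1 x.2
      rw [clusterPt_iff_nonempty] at hx
      push Not at hx
      obtain ⟨A, hA, B, hB, hAB⟩ := hx
      obtain ⟨U, hUA, hU, hxU⟩ := mem_nhds_iff.1 hA
      obtain ⟨V, hV, hVB⟩ := mem_comap.1 hB
      refine ⟨U, hU, hxU, V, hV, fun z hz hzV => ?_⟩
      have : z ∈ A ∩ B := ⟨hUA hz, hVB hzV⟩
      rw [hAB] at this
      exact this
    choose U hU hxU V hV hUV using key
    obtain ⟨t, ht⟩ := h y _ U hU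
      (fun x hx => Set.mem_iUnion.2 ⟨⟨x, hx⟩, hxU ⟨x, hx⟩⟩)
    have hVt : (⋂ i ∈ t, V i) ∈ H := (biInter_finset_mem t).2 fun i _ => hV i
    rw [clusterPt_iff_nonempty] at hy
    obtain ⟨w, hw1, hw2⟩ := hy ht hVt
    simp only [Set.mem_iUnion, Set.mem_iInter] at hw1 hw2
    obtain ⟨i, hi, z, hz, rfl⟩ := hw1
    exact hUV i z hz (hw2 i hi)
end

section
/- Let X and Y be topological spaces and let f : X → Y be surjective (no continuity assumed). Then f is countably biquotient — for every countably generated filter H on Y and every y ∈ Y, if y is a cluster point of H then there exists x with f x = y and x a cluster point of Filter.comap f H — if and only if for every y ∈ Y and every countable family (U_n)_{n ∈ ℕ} of open subsets of X with f⁻¹{y} ⊆ ⋃_n U_n, there exists a finite set t ⊆ ℕ such that ⋃_{n ∈ t} f '' U_n is a neighborhood of y. -/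
open Filter Topology

theorem stmt_11 {X Y : Type*} [TopologicalSpace X] [TopologicalSpace Y]
    (f : X → Y) (hf : Function.Surjective f) :
    (∀ H : Filter Y, H.IsCountablyGenerated →
        ∀ y : Y, ClusterPt y H → ∃ x, f x = y ∧ ClusterPt x (Filter.comap f H)) ↔
      (∀ (y : Y) (U : ℕ → Set X), (∀ n, IsOpen (U n)) →
        f ⁻¹' {y} ⊆ ⋃ n, U n →
          ∃ t : Finset ℕ, (⋃ n ∈ t, f '' U n) ∈ 𝓝 y) := by
  constructor
  · intro h y U hU hcov
    by_contra hno
    have hcl : ClusterPt y (⨅ n, 𝓟 ((f '' U n)ᶜ)) := by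
      rw [clusterPt_iff_frequently']
      intro s hs hev
      obtain ⟨t, ht, hts⟩ := (hasBasis_iInf_principal_finite _).mem_iff.1 hs
      apply hno
      refine ⟨ht.toFinset, ?_⟩
      filter_upwards [hev] with z hz
      by_contra hz'
      apply hz
      apply hts
      simp only [Set.mem_iInter]
      intro i hi hzi
      apply hz'
      simp only [Set.mem_iUnion]
      exact ⟨i, ht.mem_toFinset.2 hi, hzi⟩
    obtain ⟨x, hx, hxc⟩ := h _ inferInstance y hcl
    obtain ⟨n, hn⟩ := Set.mem_iUnion.1 (hcov (show x ∈ f ⁻¹' {y} from hx))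
    rw [clusterPt_iff_frequently'] at hxc
    have hm : (f '' U n)ᶜ ∈ ⨅ n, 𝓟 ((f '' U n)ᶜ) :=
      mem_iInf_of_mem n (mem_principal_self _)
    refine hxc _ (preimage_mem_comap hm) ?_
    filter_upwards [(hU n).mem_nhds hn] with z hz hz'
    exact hz' ⟨z, hz, rfl⟩
  · intro h H hH y hy
    obtain ⟨s, hs⟩ := H.exists_antitone_basis
    by_contra! hno
    obtain ⟨t, ht⟩ := h y (fun n => (closure (f ⁻¹' s n))ᶜ)
      (fun n => isClosed_closure.isOpen_compl) (by
        intro x hx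
        by_contra hx'
        apply hno x hx
        rw [clusterPt_iff_frequently']
        intro u hu
        obtain ⟨n, -, hn⟩ := (hs.1.comap f).mem_iff.1 hu
        simp only [Set.mem_iUnion, not_exists, Set.mem_compl_iff, not_not] at hx'
        exact (mem_closure_iff_frequently.1 (hx' n)).mono fun z hz => hn hz)
    rw [clusterPt_iff_frequently'] at hy
    refine hy _ (hs.1.mem_of_mem (i := t.sup id) trivial) ?_
    filter_upwards [ht] with z hz hz'
    simp only [Set.mem_iUnion] at hz
    obtain ⟨n, hn, x, hx, rfl⟩ := hz
    exact hx (subset_closure (hs.2 (Finset.le_sup (f := id) hn) hz'))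
end

section
/- Let X and Y be topological spaces and let f : X → Y be surjective. Then f is an open map if and only if for every y ∈ Y, every filter H ≠ ⊥ on Y with H ≤ 𝓝 y, and every x ∈ X with f x = y, there exists a filter F ≠ ⊥ on X such that F ≤ 𝓝 x and Filter.map f F = H. -/
open Filter Topology

theorem stmt_12 {X Y : Type*} [TopologicalSpace X] [TopologicalSpace Y]
    (f : X → Y) (hf : Function.Surjective f) :
    IsOpenMap f ↔
      ∀ (y : Y) (H : Filter Y), H ≠ ⊥ → H ≤ 𝓝 y →
        ∀ x : X, f x = y →
          ∃ F : Filter X, F ≠ ⊥ ∧ F ≤ 𝓝 x ∧ Filter.map f F = H := by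
  rw [isOpenMap_iff_nhds_le]
  constructor
  · rintro h y H hH hHy x rfl
    have key : Filter.map f (𝓝 x ⊓ comap f H) = H := by
      rw [Filter.push_pull]
      exact inf_eq_right.2 (hHy.trans (h x))
    refine ⟨𝓝 x ⊓ comap f H, ?_, inf_le_left, key⟩
    intro hb
    rw [hb, Filter.map_bot] at key
    exact hH key.symm
  · intro h x
    obtain ⟨F, -, hF, hm⟩ := h (f x) (𝓝 (f x)) (nhds_neBot.ne) le_rfl x rfl
    rw [← hm]
    exact Filter.map_mono hF
end

section
/- (Compactness property of filters.) Let F be a filter on a set X and suppose that for every ultrafilter U finer than F a set s(U) ∈ U is chosen. Then there exists a finite set {U₁, …, Uₙ} of ultrafilters finer than F such that s(U₁) ∪ ⋯ ∪ s(Uₙ) ∈ F. -/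
theorem stmt_13 {X : Type*} (F : Filter X) (s : Ultrafilter X → Set X)
    (hs : ∀ U : Ultrafilter X, ↑U ≤ F → s U ∈ U) :
    ∃ t : Finset (Ultrafilter X),
      (∀ U ∈ t, ↑U ≤ F) ∧ (⋃ U ∈ t, s U) ∈ F := by
  have hK : IsClosed {U : Ultrafilter X | (U : Filter X) ≤ F} := by
    have : {U : Ultrafilter X | (U : Filter X) ≤ F} = ⋂ A ∈ F, {U : Ultrafilter X | A ∈ U} := by
      ext U
      simp [Filter.le_def]
    rw [this]
    exact isClosed_biInter fun A _ => ultrafilter_isClosed_basic A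
  obtain ⟨t, ht, hc⟩ := hK.isCompact.elim_nhds_subcover
    (fun U => {V : Ultrafilter X | s U ∈ V})
    (fun U hU => (ultrafilter_isOpen_basic (s U)).mem_nhds (hs U hU))
  refine ⟨t, ht, Filter.mem_iff_ultrafilter.2 fun V hV => ?_⟩
  obtain ⟨U, hU, hUV⟩ := Set.mem_iUnion₂.1 (hc hV)
  exact Filter.mem_of_superset hUV (Set.subset_biUnion_of_mem (u := s) hU)
end

section
/- Let X and Y be topological spaces and let f : X → Y be continuous, surjective, and hereditarily quotient in the sense that for every y ∈ Y and every open set P ⊆ X with f⁻¹{y} ⊆ P, the image f '' P is a neighborhood of y. If X is a Fréchet–Urysohn space, then Y is a Fréchet–Urysohn space. -/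
open Filter Topology

theorem stmt_16 {X Y : Type*} [TopologicalSpace X] [TopologicalSpace Y]
    (f : X → Y) (hc : Continuous f) (hf : Function.Surjective f)
    (hq : ∀ (y : Y) (P : Set X), IsOpen P → f ⁻¹' {y} ⊆ P → f '' P ∈ 𝓝 y)
    [FrechetUrysohnSpace X] :
    FrechetUrysohnSpace Y := by
  refine ⟨fun A y hy => ?_⟩
  have key : ∃ x, f x = y ∧ x ∈ closure (f ⁻¹' A) := by
    by_contra h
    have h1 := hq y (closure (f ⁻¹' A))ᶜ isClosed_closure.isOpen_compl
      (fun x hx hx2 => h ⟨x, hx, hx2⟩)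
    obtain ⟨_, ⟨p, hp, rfl⟩, hA⟩ := mem_closure_iff_nhds.1 hy _ h1
    exact hp (subset_closure hA)
  obtain ⟨x, rfl, hx⟩ := key
  obtain ⟨u, hu, hl⟩ := mem_closure_iff_seq_limit.1 hx
  exact ⟨fun n => f (u n), fun n => hu n, (hc.tendsto x).comp hl⟩
end

section
/- Let X and Y be topological spaces and let f : X → Y be continuous, surjective, and countably biquotient in the filter sense: for every countably generated filter H on Y and every y ∈ Y, if y is a cluster point of H then there exists x with f x = y and x a cluster point of Filter.comap f H. If X is countably bisequential (strongly Fréchet) — i.e., for every decreasing sequence (Aₙ) of subsets of X and every point x ∈ ⋂ₙ cl(Aₙ) there exist points xₙ ∈ Aₙ with the sequence (xₙ) converging to x — then Y is countably bisequential in the same sense. -/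
open Filter Topology

theorem stmt_17 {X Y : Type*} [TopologicalSpace X] [TopologicalSpace Y]
    (f : X → Y) (hc : Continuous f) (hf : Function.Surjective f)
    (hq : ∀ H : Filter Y, H.IsCountablyGenerated →
      ∀ y : Y, ClusterPt y H → ∃ x, f x = y ∧ ClusterPt x (Filter.comap f H))
    (hX : ∀ A : ℕ → Set X, (∀ n, A (n + 1) ⊆ A n) →
      ∀ x : X, (∀ n, x ∈ closure (A n)) →
        ∃ u : ℕ → X, (∀ n, u n ∈ A n) ∧ Filter.Tendsto u Filter.atTop (𝓝 x)) :
    ∀ B : ℕ → Set Y, (∀ n, B (n + 1) ⊆ B n) →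
      ∀ y : Y, (∀ n, y ∈ closure (B n)) →
        ∃ v : ℕ → Y, (∀ n, v n ∈ B n) ∧ Filter.Tendsto v Filter.atTop (𝓝 y) := by
  intro B hB y hy
  have hanti : Antitone B := antitone_nat_of_succ_le hB
  have hbas : (⨅ n, 𝓟 (B n)).HasBasis (fun _ : ℕ => True) B :=
    hasBasis_iInf_principal (directed_of_isDirected_le (fun i j h => hanti h))
  have hcg : (⨅ n, 𝓟 (B n)).IsCountablyGenerated := hbas.isCountablyGenerated
  have hcl : ClusterPt y (⨅ n, 𝓟 (B n)) := by
    rw [ClusterPt, (𝓝 y).basis_sets.inf_basis_neBot_iff hbas]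
    intro U hU n _
    exact mem_closure_iff_nhds.1 (hy n) U hU
  obtain ⟨x, rfl, hx⟩ := hq _ hcg y hcl
  obtain ⟨u, hu, hlim⟩ := hX (fun n => f ⁻¹' B n)
    (fun n => Set.preimage_mono (hB n)) x (fun n => by
      rw [mem_closure_iff_clusterPt]
      exact hx.mono (le_principal_iff.2 (preimage_mem_comap (hbas.mem_of_mem trivial))))
  exact ⟨fun n => f (u n), hu, (hc.tendsto x).comp hlim⟩
end

section
/- A filter E on a set X is a sequential filter — i.e., there exists a sequence x : ℕ → X such that the sets {xₙ : n ≥ m}, m ∈ ℕ, form a base of E — if and only if there exist sets A ⊆ B ⊆ X with B countable, with A nonempty or B infinite, such that E is the cofinite filter of B centered at A, namely E = {F ⊆ X : A ⊆ F and B \ F is finite}. -/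
theorem aux_key {X : Type*} (x : ℕ → X) (F : Set X) :
    (∃ m, {y | ∃ n ≥ m, y = x n} ⊆ F) ↔
      {y | {n | x n = y}.Infinite} ⊆ F ∧ (Set.range x \ F).Finite := by
  constructor
  · rintro ⟨m, hm⟩
    refine ⟨fun y hy => ?_, ?_⟩
    · obtain ⟨n, hn, hmn⟩ := Set.Infinite.exists_gt hy m
      exact hm ⟨n, hmn.le, hn.symm⟩
    · refine ((Set.finite_lt_nat m).image x).subset ?_
      rintro _ ⟨⟨n, rfl⟩, hn⟩
      refine ⟨n, ?_, rfl⟩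
      by_contra h
      exact hn (hm ⟨n, not_lt.mp h, rfl⟩)
  · rintro ⟨hA, hB⟩
    have hfin : {n | x n ∉ F}.Finite := by
      refine (hB.biUnion (t := fun y => {n | x n = y}) ?_).subset ?_
      · intro y hy
        by_contra h
        exact hy.2 (hA h)
      · intro n hn
        exact Set.mem_biUnion (x := x n) ⟨⟨n, rfl⟩, hn⟩ rfl
    obtain ⟨m, hm⟩ := hfin.bddAbove
    refine ⟨m + 1, ?_⟩
    rintro _ ⟨n, hn, rfl⟩
    by_contra h
    have : n ≤ m := hm h
    omega

theorem stmt_19 {X : Type*} [Nonempty X] (E : Filter X) :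
    (∃ x : ℕ → X, E.HasBasis (fun _ : ℕ => True) fun m => {y | ∃ n ≥ m, y = x n}) ↔
      ∃ A B : Set X, A ⊆ B ∧ B.Countable ∧ (A.Nonempty ∨ B.Infinite) ∧
        ∀ F : Set X, F ∈ E ↔ A ⊆ F ∧ (B \ F).Finite := by
  constructor
  · rintro ⟨x, hx⟩
    refine ⟨{y | {n | x n = y}.Infinite}, Set.range x, ?_, Set.countable_range x, ?_, ?_⟩
    · intro y hy
      obtain ⟨n, hn⟩ := Set.Infinite.nonempty hy
      exact ⟨n, hn⟩
    · by_contra h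
      push Not at h
      obtain ⟨m, hm⟩ := (aux_key x ∅).2 ⟨h.1.subset, by simpa using h.2⟩
      exact hm ⟨m, le_rfl, rfl⟩
    · intro F
      rw [← aux_key, hx.mem_iff]
      simp
  · rintro ⟨A, B, hAB, hB, hne, hE⟩
    let T : Set (X × ℕ) := {p | p.1 ∈ B ∧ (p.1 ∈ A ∨ p.2 = 0)}
    have hTc : T.Countable :=
      (hB.prod (Set.countable_univ (α := ℕ))).mono (fun p (hp : p ∈ T) => Set.mk_mem_prod hp.1 (Set.mem_univ p.2))
    have hTi : T.Infinite := by
      rcases hne with ⟨a, ha⟩ | hBi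
      · refine Set.infinite_of_injective_forall_mem (f := fun k : ℕ => (a, k)) ?_ ?_
        · intro i j h
          simpa using h
        · exact fun k => ⟨hAB ha, Or.inl ha⟩
      · refine (hBi.image (f := fun b => (b, 0)) ?_).mono ?_
        · intro i _ j _ h
          simpa using h
        · rintro _ ⟨b, hb, rfl⟩
          exact ⟨hb, Or.inr rfl⟩
    have := hTc.to_subtype
    have := hTi.to_subtype
    obtain ⟨e⟩ : Nonempty (ℕ ≃ T) := nonempty_equiv_of_countable
    refine ⟨fun n => (e n).1.1, ⟨fun F => ?_⟩⟩
    have h1 : Set.range (fun n => (e n).1.1) = B := by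
      ext b
      constructor
      · rintro ⟨n, rfl⟩
        exact (e n).2.1
      · intro hb
        exact ⟨e.symm ⟨(b, 0), hb, Or.inr rfl⟩, by simp⟩
    have h2 : {y | {n | (e n).1.1 = y}.Infinite} = A := by
      ext a
      constructor
      · intro ha
        by_contra hna
        refine ha (Set.Subsingleton.finite ?_)
        intro i hi j hj
        have hi' : (e i).1.1 = a := hi
        have hj' : (e j).1.1 = a := hj
        apply e.injective
        apply Subtype.ext
        have := (e i).2.2
        have := (e j).2.2
        apply Prod.ext
        · rw [hi', hj']
        · simp_all
      · intro ha
        refine Set.infinite_of_injective_forall_mem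
          (f := fun k : ℕ => e.symm ⟨(a, k), hAB ha, Or.inl ha⟩) ?_ ?_
        · intro i j h
          simpa using h
        · intro k
          simp
    have := aux_key (fun n => (e n).1.1) F
    rw [h1, h2] at this
    rw [hE, ← this]
    simp
end
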